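/- Let m, q∞ > 0, ϑ₀ ∈ (0, π/2), and ϑ(t) = (1/2)·arccot(cot(2ϑ₀) + m t/(4q∞²)). Let h = (h₁, h₂) : [0,∞) → ℝ² be continuous and suppose there are a, b ≥ 0 with |h₁(t)| ≤ a and |h₂(t)| ≤ b(1+t)^{−3} for all t ≥ 0. Then the function ξ(t) = e^{−B(ϑ(t))}·( ∫₀^t (e^{B(ϑ(τ))} h(τ))₁ dτ , ∫_t^∞ (e^{B(ϑ(τ))} h(τ))₂ dτ ) is well defined (the improper integral converges), and there is a constant C > 0 depending only on m, q∞, ϑ₀ such that |ξ₁(t)| ≤ C(1+t)(a+b) and |ξ₂(t)| ≤ C(a+b)(1+t)^{−2} for all t ≥ 0. -/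

import Mathlib

open MeasureTheory Metric Real Filter Topology Set

noncomputable section

/-- `arccot`, with values in `(0, π)`. -/
def arccotR (x : ℝ) : ℝ := π / 2 - Real.arctan x

/-- The explicit angle `ϑ(t) = (1/2)·arccot(cot(2ϑ₀) + m t/(4q∞²))`. -/
def thetaF (m qinf ϑ₀ t : ℝ) : ℝ :=
  (1 / 2) * arccotR (Real.cot (2 * ϑ₀) + m * t / (4 * qinf ^ 2))

/-- `p*(t) = q∞ / sin ϑ(t)`. -/
def pstarF (m qinf ϑ₀ t : ℝ) : ℝ := qinf / Real.sin (thetaF m qinf ϑ₀ t)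

/-- `q*(t) = q∞ / cos ϑ(t)`. -/
def qstarF (m qinf ϑ₀ t : ℝ) : ℝ := qinf / Real.cos (thetaF m qinf ϑ₀ t)

/-- `r(t) = 2q∞ / sin(2ϑ(t))`, so that `p* + i q* = r e^{iϑ}`. -/
def rstarF (m qinf ϑ₀ t : ℝ) : ℝ := 2 * qinf / Real.sin (2 * thetaF m qinf ϑ₀ t)

/-- The point-vortex nonlinearity `F(x,y) = (m/2)(1/x − x/(x²+y²))`. -/
def Fpv (m x y : ℝ) : ℝ := (m / 2) * (1 / x - x / (x ^ 2 + y ^ 2))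

/-- The linearization matrix `A(p,q)` of the point-vortex system. -/
def Apv (m p q : ℝ) : Matrix (Fin 2) (Fin 2) ℝ :=
  (m / 2) • !![-2 * p * q / (p ^ 2 + q ^ 2) ^ 2,
               1 / q ^ 2 + (p ^ 2 - q ^ 2) / (p ^ 2 + q ^ 2) ^ 2;
               -1 / p ^ 2 + (p ^ 2 - q ^ 2) / (p ^ 2 + q ^ 2) ^ 2,
               2 * p * q / (p ^ 2 + q ^ 2) ^ 2]

/-- The matrix `B(ϑ)`. -/
def Bmat (ϑ : ℝ) : Matrix (Fin 2) (Fin 2) ℝ :=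
  !![-(1 / 2) * Real.cos (2 * ϑ),
     Real.cos ϑ / Real.sin ϑ - (1 / 2) * Real.sin (2 * ϑ);
     Real.sin ϑ / Real.cos ϑ - (1 / 2) * Real.sin (2 * ϑ),
     (1 / 2) * Real.cos (2 * ϑ)]

/-- The matrix `M(ϑ)`. -/
def Mmat (ϑ : ℝ) : Matrix (Fin 2) (Fin 2) ℝ :=
  !![Real.sin (2 * ϑ), -1 / Real.sin ϑ ^ 2 - Real.cos (2 * ϑ);
     1 / Real.cos ϑ ^ 2 - Real.cos (2 * ϑ), -Real.sin (2 * ϑ)]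

/-- The matrix exponential, as the sum of the exponential power series. -/
def matExp (A : Matrix (Fin 2) (Fin 2) ℝ) : Matrix (Fin 2) (Fin 2) ℝ :=
  ∑' n : ℕ, ((n.factorial : ℝ)⁻¹) • A ^ n

/-- The solution operator `ξ = K h`:
`ξ(t) = e^{−B(ϑ(t))}·(∫₀ᵗ (e^{B(ϑ)}h)₁ dτ, ∫ₜ^∞ (e^{B(ϑ)}h)₂ dτ)`. -/
def xiSol (m qinf ϑ₀ : ℝ) (h : ℝ → Fin 2 → ℝ) (t : ℝ) : Fin 2 → ℝ :=
  (matExp (-Bmat (thetaF m qinf ϑ₀ t))).mulVec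
    ![∫ τ in (0:ℝ)..t, ((matExp (Bmat (thetaF m qinf ϑ₀ τ))).mulVec (h τ)) 0,
      ∫ τ in Set.Ioi t, ((matExp (Bmat (thetaF m qinf ϑ₀ τ))).mulVec (h τ)) 1]

lemma matExp_of_mul_self {A : Matrix (Fin 2) (Fin 2) ℝ} (hA : A * A = (1 / 4 : ℝ) • 1) :
    matExp A = Real.cosh (1 / 2) • 1 + (2 * Real.sinh (1 / 2)) • A := by
  have hpow : ∀ n : ℕ, A ^ n = ((1 / 2 : ℝ) ^ n) • ((1 / 2 : ℝ) • 1 + A)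
      + ((-(1 / 2) : ℝ) ^ n) • ((1 / 2 : ℝ) • 1 - A) := by
    intro n
    induction n with
    | zero =>
      simp only [pow_zero, one_smul]
      module
    | succ k ih =>
      rw [pow_succ, ih]
      simp only [add_mul, sub_mul, smul_mul_assoc, one_mul, hA, pow_succ]
      module
  have hexp : ∀ x : ℝ, HasSum (fun n : ℕ => (n.factorial : ℝ)⁻¹ * x ^ n) (Real.exp x) := by
    intro x
    rw [Real.exp_eq_exp_ℝ]
    simpa [smul_eq_mul] using NormedSpace.exp_series_hasSum_exp' (𝕂 := ℝ) x
  have hsum := ((hexp (1 / 2)).smul_const ((1 / 2 : ℝ) • (1 : Matrix (Fin 2) (Fin 2) ℝ) + A)).add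
    ((hexp (-(1 / 2))).smul_const ((1 / 2 : ℝ) • (1 : Matrix (Fin 2) (Fin 2) ℝ) - A))
  simp only [matExp, hpow, smul_add (_ : ℝ) ((_ : ℝ) ^ _ • _), smul_smul _ (_ ^ _)]
  rw [hsum.tsum_eq, Real.cosh_eq, Real.sinh_eq]
  module

lemma thetaF_mem_Ioo (m qinf ϑ₀ t : ℝ) : thetaF m qinf ϑ₀ t ∈ Ioo 0 (π / 2) := by
  have h1 := Real.arctan_lt_pi_div_two (Real.cot (2 * ϑ₀) + m * t / (4 * qinf ^ 2))
  have h2 := Real.neg_pi_div_two_lt_arctan (Real.cot (2 * ϑ₀) + m * t / (4 * qinf ^ 2))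
  constructor <;> simp only [thetaF, arccotR] <;> linarith

lemma sin_thetaF_pos (m qinf ϑ₀ t : ℝ) : 0 < Real.sin (thetaF m qinf ϑ₀ t) := by
  have h := thetaF_mem_Ioo m qinf ϑ₀ t
  exact Real.sin_pos_of_pos_of_lt_pi h.1 (by linarith [h.2, Real.pi_pos])

lemma cos_thetaF_pos (m qinf ϑ₀ t : ℝ) : 0 < Real.cos (thetaF m qinf ϑ₀ t) := by
  have h := thetaF_mem_Ioo m qinf ϑ₀ t
  exact Real.cos_pos_of_mem_Ioo ⟨by linarith [h.1, Real.pi_pos], h.2⟩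

lemma cot_sub_tan_thetaF (m qinf ϑ₀ t : ℝ) :
    Real.cos (thetaF m qinf ϑ₀ t) / Real.sin (thetaF m qinf ϑ₀ t)
      - Real.sin (thetaF m qinf ϑ₀ t) / Real.cos (thetaF m qinf ϑ₀ t)
      = 2 * (Real.cot (2 * ϑ₀) + m * t / (4 * qinf ^ 2)) := by
  have hs := (sin_thetaF_pos m qinf ϑ₀ t).ne'
  have hc := (cos_thetaF_pos m qinf ϑ₀ t).ne'
  set x := Real.cot (2 * ϑ₀) + m * t / (4 * qinf ^ 2) with hx
  have harc : Real.arctan x = π / 2 - 2 * thetaF m qinf ϑ₀ t := by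
    simp only [thetaF, arccotR, ← hx]
    ring
  have htan : x = Real.cos (2 * thetaF m qinf ϑ₀ t) / Real.sin (2 * thetaF m qinf ϑ₀ t) := by
    rw [← Real.tan_arctan x, harc, Real.tan_eq_sin_div_cos, Real.sin_pi_div_two_sub,
      Real.cos_pi_div_two_sub]
  rw [htan, Real.cos_two_mul', Real.sin_two_mul]
  field_simp

lemma continuous_thetaF (m qinf ϑ₀ : ℝ) : Continuous (thetaF m qinf ϑ₀) := by
  unfold thetaF arccotR
  fun_prop

lemma Bmat_mul_self {ϑ : ℝ} (hs : Real.sin ϑ ≠ 0) (hc : Real.cos ϑ ≠ 0) :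
    Bmat ϑ * Bmat ϑ = (1 / 4 : ℝ) • 1 := by
  have h1 := Real.sin_sq_add_cos_sq ϑ
  have h2 : Real.cos ϑ ^ 2 = 1 - Real.sin ϑ ^ 2 := by linarith
  ext i j
  fin_cases i <;> fin_cases j <;>
    simp [Bmat, Matrix.mul_apply, Fin.sum_univ_two, Real.sin_two_mul, Real.cos_two_mul'] <;>
    field_simp
  · simp only [h2]; ring
  · ring
  · ring
  · simp only [h2]; ring

/-- Entrywise bounds for `2 × 2` matrices `A` with the decay and growth in `t` of `B(ϑ(t))`. -/
def EntryBound (M t : ℝ) (A : Matrix (Fin 2) (Fin 2) ℝ) : Prop :=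
  |A 0 0| ≤ M ∧ |A 0 1| ≤ M * (1 + t) ∧ |A 1 0| ≤ M / (1 + t) ^ 3 ∧ |A 1 1| ≤ M

lemma tan_thetaF_le {m qinf : ℝ} (ϑ₀ : ℝ) (hm : 0 < m) (hq : 0 < qinf) :
    ∃ L > 0, ∀ t : ℝ, 0 ≤ t →
      Real.sin (thetaF m qinf ϑ₀ t) / Real.cos (thetaF m qinf ϑ₀ t) ≤ L / (1 + t) ∧
      Real.cos (thetaF m qinf ϑ₀ t) / Real.sin (thetaF m qinf ϑ₀ t) ≤ L * (1 + t) := by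
  set c := Real.cot (2 * ϑ₀) with hc
  set k := m / (4 * qinf ^ 2) with hk
  have hkpos : 0 < k := by positivity
  set D := 1 + 2 * |c| with hD
  have hc0 := abs_nonneg c
  refine ⟨D + (1 + D ^ 2) / (2 * k) + 2 * D + 2 * k, by positivity, fun t ht => ?_⟩
  have hrel := cot_sub_tan_thetaF m qinf ϑ₀ t
  have hsin := sin_thetaF_pos m qinf ϑ₀ t
  have hcos := cos_thetaF_pos m qinf ϑ₀ t
  set u := Real.sin (thetaF m qinf ϑ₀ t) / Real.cos (thetaF m qinf ϑ₀ t) with hu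
  set y := Real.cos (thetaF m qinf ϑ₀ t) / Real.sin (thetaF m qinf ϑ₀ t) with hy
  have huy : u * y = 1 := by rw [hu, hy]; field_simp
  have hupos : 0 < u := by positivity
  have hypos : 0 < y := by positivity
  have hkt : m * t / (4 * qinf ^ 2) = k * t := by rw [hk]; ring
  rw [← hc, hkt] at hrel
  have hktn : 0 ≤ k * t := by positivity
  have hcl := neg_abs_le c
  have hcu := le_abs_self c
  have huD : u ≤ D := by
    by_contra! hlt
    have hy1 : y < 1 := by nlinarith
    linarith
  have hut : u * t ≤ (1 + D ^ 2) / (2 * k) := by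
    rw [le_div_iff₀ (by positivity)]
    have h1 : u * (2 * (c + k * t)) = 1 - u ^ 2 := by rw [← hrel]; linear_combination huy
    nlinarith [mul_le_mul_of_nonneg_left hcl hupos.le, mul_le_mul_of_nonneg_right huD hc0,
      sq_nonneg u]
  have hfrac : 0 ≤ (1 + D ^ 2) / (2 * k) := by positivity
  constructor
  · rw [le_div_iff₀ (by positivity)]
    nlinarith
  · nlinarith [mul_nonneg hfrac ht, mul_nonneg hc0 ht]

lemma entryBound_Bmat_thetaF {m qinf : ℝ} (ϑ₀ : ℝ) (hm : 0 < m) (hq : 0 < qinf) :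
    ∃ M > 0, ∀ t : ℝ, 0 ≤ t → EntryBound M t (Bmat (thetaF m qinf ϑ₀ t)) := by
  obtain ⟨L, hL, hbd⟩ := tan_thetaF_le ϑ₀ hm hq
  refine ⟨1 + L + L ^ 3, by positivity, fun t ht => ?_⟩
  obtain ⟨htan, hcot⟩ := hbd t ht
  have hsin := sin_thetaF_pos m qinf ϑ₀ t
  have hcos := cos_thetaF_pos m qinf ϑ₀ t
  set ϑ := thetaF m qinf ϑ₀ t
  have h1 := Real.sin_sq_add_cos_sq ϑ
  have hL3 : 0 < L ^ 3 := by positivity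
  have hcos2 : |Real.cos (2 * ϑ)| ≤ 1 := Real.abs_cos_le_one _
  have hc2 : Real.cos ϑ ^ 2 ≤ 1 := Real.cos_sq_le_one ϑ
  have h01 : Real.cos ϑ / Real.sin ϑ - 1 / 2 * Real.sin (2 * ϑ)
      = Real.cos ϑ / Real.sin ϑ * Real.cos ϑ ^ 2 := by
    rw [Real.sin_two_mul, Real.cos_sq']; field_simp
  have h10 : Real.sin ϑ / Real.cos ϑ - 1 / 2 * Real.sin (2 * ϑ)
      = (Real.sin ϑ / Real.cos ϑ) ^ 3 * Real.cos ϑ ^ 2 := by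
    rw [Real.sin_two_mul]; field_simp; linear_combination -h1
  refine ⟨?_, ?_, ?_, ?_⟩
  · simp only [Bmat, Matrix.of_apply, Matrix.cons_val', Matrix.cons_val_zero, abs_mul, abs_neg]
    norm_num
    linarith
  · have : Bmat ϑ 0 1 = Real.cos ϑ / Real.sin ϑ * Real.cos ϑ ^ 2 := h01
    rw [this, abs_of_pos (by positivity)]
    have h2 : Real.cos ϑ / Real.sin ϑ * Real.cos ϑ ^ 2 ≤ Real.cos ϑ / Real.sin ϑ :=
      mul_le_of_le_one_right (by positivity) hc2
    nlinarith
  · have : Bmat ϑ 1 0 = (Real.sin ϑ / Real.cos ϑ) ^ 3 * Real.cos ϑ ^ 2 := h10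
    rw [this, abs_of_pos (by positivity)]
    calc (Real.sin ϑ / Real.cos ϑ) ^ 3 * Real.cos ϑ ^ 2
        ≤ (Real.sin ϑ / Real.cos ϑ) ^ 3 := mul_le_of_le_one_right (by positivity) hc2
      _ ≤ (L / (1 + t)) ^ 3 := by gcongr
      _ = L ^ 3 / (1 + t) ^ 3 := div_pow _ _ _
      _ ≤ (1 + L + L ^ 3) / (1 + t) ^ 3 := by gcongr; linarith
  · have : Bmat ϑ 1 1 = 1 / 2 * Real.cos (2 * ϑ) := rfl
    rw [this, abs_mul]
    norm_num
    linarith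

lemma EntryBound.neg {M t : ℝ} {A : Matrix (Fin 2) (Fin 2) ℝ} (hA : EntryBound M t A) :
    EntryBound M t (-A) := by
  simpa [EntryBound] using hA

lemma EntryBound.smul_one_add_smul {M t α β : ℝ} {A : Matrix (Fin 2) (Fin 2) ℝ}
    (hA : EntryBound M t A) (ht : 0 ≤ t) (hα : 0 ≤ α) (hβ : 0 ≤ β) :
    EntryBound (α + β * M) t (α • 1 + β • A) := by
  obtain ⟨h00, h01, h10, h11⟩ := hA
  have hdiag : ∀ x : ℝ, |x| ≤ M → |α + β * x| ≤ α + β * M := fun x hx =>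
    calc |α + β * x| ≤ |α| + |β * x| := abs_add_le _ _
      _ = α + β * |x| := by rw [abs_mul, abs_of_nonneg hα, abs_of_nonneg hβ]
      _ ≤ α + β * M := by gcongr
  refine ⟨?_, ?_, ?_, ?_⟩
  · simpa using hdiag _ h00
  · have : |(α • (1 : Matrix (Fin 2) (Fin 2) ℝ) + β • A) 0 1| = β * |A 0 1| := by
      simp [abs_mul, abs_of_nonneg hβ]
    rw [this]
    nlinarith [mul_le_mul_of_nonneg_left h01 hβ, mul_nonneg hα ht]
  · have : |(α • (1 : Matrix (Fin 2) (Fin 2) ℝ) + β • A) 1 0| = β * |A 1 0| := by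
      simp [abs_mul, abs_of_nonneg hβ]
    rw [this]
    calc β * |A 1 0| ≤ β * (M / (1 + t) ^ 3) := by gcongr
      _ = β * M / (1 + t) ^ 3 := by ring
      _ ≤ (α + β * M) / (1 + t) ^ 3 := by gcongr; linarith
  · simpa using hdiag _ h11

lemma matExp_Bmat_thetaF (m qinf ϑ₀ t : ℝ) : matExp (Bmat (thetaF m qinf ϑ₀ t)) =
    Real.cosh (1 / 2) • 1 + (2 * Real.sinh (1 / 2)) • Bmat (thetaF m qinf ϑ₀ t) :=
  matExp_of_mul_self
    (Bmat_mul_self (sin_thetaF_pos m qinf ϑ₀ t).ne' (cos_thetaF_pos m qinf ϑ₀ t).ne')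

lemma matExp_neg_Bmat_thetaF (m qinf ϑ₀ t : ℝ) : matExp (-Bmat (thetaF m qinf ϑ₀ t)) =
    Real.cosh (1 / 2) • 1 + (2 * Real.sinh (1 / 2)) • -Bmat (thetaF m qinf ϑ₀ t) :=
  matExp_of_mul_self (by
    rw [neg_mul_neg]
    exact Bmat_mul_self (sin_thetaF_pos m qinf ϑ₀ t).ne' (cos_thetaF_pos m qinf ϑ₀ t).ne')

lemma entryBound_matExp {m qinf : ℝ} (ϑ₀ : ℝ) (hm : 0 < m) (hq : 0 < qinf) :
    ∃ K > 0, ∀ t : ℝ, 0 ≤ t → EntryBound K t (matExp (Bmat (thetaF m qinf ϑ₀ t))) ∧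
      EntryBound K t (matExp (-Bmat (thetaF m qinf ϑ₀ t))) := by
  obtain ⟨M, hM, hB⟩ := entryBound_Bmat_thetaF ϑ₀ hm hq
  have hch := Real.cosh_pos (1 / 2)
  have hsh : 0 ≤ 2 * Real.sinh (1 / 2) := by
    have := Real.sinh_nonneg_iff.2 (show (0 : ℝ) ≤ 1 / 2 by norm_num)
    linarith
  refine ⟨Real.cosh (1 / 2) + 2 * Real.sinh (1 / 2) * M, by positivity, fun t ht => ⟨?_, ?_⟩⟩
  · rw [matExp_Bmat_thetaF]
    exact (hB t ht).smul_one_add_smul ht hch.le hsh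
  · rw [matExp_neg_Bmat_thetaF]
    exact (hB t ht).neg.smul_one_add_smul ht hch.le hsh

lemma continuous_matExp_Bmat_thetaF (m qinf ϑ₀ : ℝ) :
    Continuous fun t => matExp (Bmat (thetaF m qinf ϑ₀ t)) := by
  have hϑ := continuous_thetaF m qinf ϑ₀
  have hs := fun t => (sin_thetaF_pos m qinf ϑ₀ t).ne'
  have hc := fun t => (cos_thetaF_pos m qinf ϑ₀ t).ne'
  simp only [matExp_Bmat_thetaF]
  have hB : Continuous fun t => Bmat (thetaF m qinf ϑ₀ t) := by
    refine continuous_matrix fun i j => ?_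
    fin_cases i <;> fin_cases j <;> simp [Bmat] <;> fun_prop (disch := assumption)
  fun_prop

lemma integrableOn_Ioi_one_add_pow_neg_three {t : ℝ} (ht : 0 ≤ t) :
    IntegrableOn (fun τ : ℝ => 1 / (1 + τ) ^ 3) (Ioi t) ∧
      ∫ τ in Ioi t, 1 / (1 + τ) ^ 3 = 1 / (2 * (1 + t) ^ 2) := by
  have hderiv : ∀ x ∈ Ici t,
      HasDerivAt (fun τ : ℝ => -(1 / 2) * ((1 + τ) ^ 2)⁻¹) (1 / (1 + x) ^ 3) x := by
    intro x hx
    have hx0 : 1 + x ≠ 0 := by have := mem_Ici.1 hx; linarith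
    have h := ((((hasDerivAt_id x).const_add 1).pow 2).inv (pow_ne_zero 2 hx0)).const_mul
      (-(1 / 2) : ℝ)
    refine h.congr_deriv ?_
    simp
    field_simp
  have hpos : ∀ x ∈ Ioi t, 0 ≤ 1 / (1 + x) ^ 3 := by
    intro x hx
    have : 0 < 1 + x := by have := mem_Ioi.1 hx; linarith
    positivity
  have hlim : Tendsto (fun τ : ℝ => -(1 / 2) * ((1 + τ) ^ 2)⁻¹) atTop (𝓝 0) := by
    have h1 : Tendsto (fun τ : ℝ => (1 + τ) ^ 2) atTop atTop :=
      (tendsto_pow_atTop two_ne_zero).comp (tendsto_atTop_add_const_left _ 1 tendsto_id)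
    simpa using h1.inv_tendsto_atTop.const_mul (-(1 / 2) : ℝ)
  refine ⟨integrableOn_Ioi_deriv_of_nonneg' hderiv hpos hlim, ?_⟩
  rw [integral_Ioi_of_hasDerivAt_of_nonneg' hderiv hpos hlim]
  have : 1 + t ≠ 0 := by linarith
  field_simp
  ring

lemma EntryBound.abs_mulVec_zero_le {M t p q : ℝ} {A : Matrix (Fin 2) (Fin 2) ℝ}
    {v : Fin 2 → ℝ} (hA : EntryBound M t A) (hM : 0 ≤ M) (ht : 0 ≤ t) (h0 : |v 0| ≤ p)
    (h1 : |v 1| ≤ q) : |A.mulVec v 0| ≤ M * p + M * (1 + t) * q := by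
  obtain ⟨h00, h01, -, -⟩ := hA
  simp only [Matrix.mulVec, dotProduct, Fin.sum_univ_two]
  refine (abs_add_le _ _).trans ?_
  rw [abs_mul, abs_mul]
  gcongr

lemma EntryBound.abs_mulVec_one_le {M t p q : ℝ} {A : Matrix (Fin 2) (Fin 2) ℝ}
    {v : Fin 2 → ℝ} (hA : EntryBound M t A) (hM : 0 ≤ M) (ht : 0 ≤ t) (h0 : |v 0| ≤ p)
    (h1 : |v 1| ≤ q) : |A.mulVec v 1| ≤ M / (1 + t) ^ 3 * p + M * q := by
  obtain ⟨-, -, h10, h11⟩ := hA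
  simp only [Matrix.mulVec, dotProduct, Fin.sum_univ_two]
  refine (abs_add_le _ _).trans ?_
  rw [abs_mul, abs_mul]
  gcongr

/-- for continuous `h` with `|h₁| ≤ a` and `|h₂| ≤ b(1+t)⁻³`, the function
`ξ = K h` is well defined (the improper integral converges) and satisfies
`|ξ₁(t)| ≤ C(1+t)(a+b)`, `|ξ₂(t)| ≤ C(a+b)(1+t)⁻²` with `C` depending only on
`m, q∞, ϑ₀`. -/
theorem statement_13 (m qinf ϑ₀ : ℝ) (hm : 0 < m) (hq : 0 < qinf)
    (hϑ : ϑ₀ ∈ Ioo (0:ℝ) (π / 2)) :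
    ∃ C > 0, ∀ (h : ℝ → Fin 2 → ℝ) (a b : ℝ),
      Continuous h → 0 ≤ a → 0 ≤ b →
      (∀ t : ℝ, 0 ≤ t → |h t 0| ≤ a) →
      (∀ t : ℝ, 0 ≤ t → |h t 1| ≤ b / (1 + t) ^ 3) →
      ∀ t : ℝ, 0 ≤ t →
        IntegrableOn
          (fun τ : ℝ => ((matExp (Bmat (thetaF m qinf ϑ₀ τ))).mulVec (h τ)) 1)
          (Set.Ioi t) ∧
        |xiSol m qinf ϑ₀ h t 0| ≤ C * (1 + t) * (a + b) ∧
        |xiSol m qinf ϑ₀ h t 1| ≤ C * (a + b) / (1 + t) ^ 2 := by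
  obtain ⟨K, hK, hE⟩ := entryBound_matExp ϑ₀ hm hq
  refine ⟨2 * K ^ 2, by positivity, fun h a b hh ha hb h0 h1 t ht => ?_⟩
  have hcont : Continuous fun τ => (matExp (Bmat (thetaF m qinf ϑ₀ τ))).mulVec (h τ) :=
    (continuous_matExp_Bmat_thetaF m qinf ϑ₀).matrix_mulVec hh
  have hint0 : ∀ τ : ℝ, 0 ≤ τ →
      |(matExp (Bmat (thetaF m qinf ϑ₀ τ))).mulVec (h τ) 0| ≤ K * (a + b) := by
    intro τ hτ
    refine ((hE τ hτ).1.abs_mulVec_zero_le hK.le hτ (h0 τ hτ) (h1 τ hτ)).trans ?_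
    have hle : (1 + τ) * (b / (1 + τ) ^ 3) ≤ b := by
      have hp : (1 : ℝ) ≤ (1 + τ) ^ 2 := one_le_pow₀ (by linarith)
      calc (1 + τ) * (b / (1 + τ) ^ 3) = b / (1 + τ) ^ 2 := by field_simp
        _ ≤ b := div_le_self hb hp
    rw [mul_assoc, ← mul_add]
    gcongr
  have hint1 : ∀ τ : ℝ, 0 ≤ τ →
      |(matExp (Bmat (thetaF m qinf ϑ₀ τ))).mulVec (h τ) 1| ≤
        K * (a + b) * (1 / (1 + τ) ^ 3) := by
    intro τ hτ
    refine ((hE τ hτ).1.abs_mulVec_one_le hK.le hτ (h0 τ hτ) (h1 τ hτ)).trans_eq ?_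
    ring
  obtain ⟨hpow, hpow_eq⟩ := integrableOn_Ioi_one_add_pow_neg_three ht
  have hae : ∀ᵐ τ ∂volume.restrict (Ioi t),
      ‖(matExp (Bmat (thetaF m qinf ϑ₀ τ))).mulVec (h τ) 1‖ ≤
        K * (a + b) * (1 / (1 + τ) ^ 3) := by
    filter_upwards [ae_restrict_mem measurableSet_Ioi] with τ hτ
    exact hint1 τ (ht.trans (mem_Ioi.1 hτ).le)
  have hI0 : |∫ τ in (0 : ℝ)..t, (matExp (Bmat (thetaF m qinf ϑ₀ τ))).mulVec (h τ) 0| ≤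
      K * (a + b) * t := by
    have := intervalIntegral.norm_integral_le_of_norm_le_const (a := 0) (b := t)
      (C := K * (a + b))
      (f := fun τ => (matExp (Bmat (thetaF m qinf ϑ₀ τ))).mulVec (h τ) 0) (by
        intro τ hτ
        rw [uIoc_of_le ht] at hτ
        exact hint0 τ hτ.1.le)
    rwa [sub_zero, abs_of_nonneg ht] at this
  have hI1 : |∫ τ in Ioi t, (matExp (Bmat (thetaF m qinf ϑ₀ τ))).mulVec (h τ) 1| ≤
      K * (a + b) / (1 + t) ^ 2 := by
    have := norm_integral_le_of_norm_le (hpow.const_mul (K * (a + b))) hae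
    rw [integral_const_mul, hpow_eq] at this
    refine this.trans ?_
    rw [mul_one_div]
    gcongr
    nlinarith [sq_nonneg (1 + t)]
  have hKab : 0 ≤ K ^ 2 * (a + b) := by positivity
  refine ⟨(hpow.const_mul (K * (a + b))).mono'
    ((continuous_apply 1).comp hcont).aestronglyMeasurable hae, ?_, ?_⟩
  · refine ((hE t ht).2.abs_mulVec_zero_le hK.le ht hI0 hI1).trans ?_
    have h2 : K * (1 + t) * (K * (a + b) / (1 + t) ^ 2) = K ^ 2 * (a + b) / (1 + t) := by
      field_simp
    have h3 : K ^ 2 * (a + b) / (1 + t) ≤ K ^ 2 * (a + b) := div_le_self hKab (by linarith)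
    rw [h2]
    nlinarith [mul_nonneg hKab ht]
  · refine ((hE t ht).2.abs_mulVec_one_le hK.le ht hI0 hI1).trans ?_
    have h2 : K / (1 + t) ^ 3 * (K * (a + b) * t)
        = K ^ 2 * (a + b) / (1 + t) ^ 2 * (t / (1 + t)) := by
      field_simp
    have h3 : K ^ 2 * (a + b) / (1 + t) ^ 2 * (t / (1 + t)) ≤ K ^ 2 * (a + b) / (1 + t) ^ 2 :=
      mul_le_of_le_one_right (by positivity) ((div_le_one (by positivity)).2 (by linarith))
    rw [h2]
    refine (add_le_add_left h3 _).trans_eq ?_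
    ring
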